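/- Let $\Psi:\mathbb{R}^d\to\mathbb{R}$ be convex, $L$-smooth, and minimized at $0$. Let $\rho\in(0,1)$, $\eta=\sqrt{1-\rho^2}$, and $\mathsf{C}$ a positive definite covariance matrix. Then the pCN acceptance probability satisfies, for all $x\in\mathbb{R}^d$: $\alpha(x) = \int\mathcal{N}(dz;0,\mathsf{C})\min\{1,\exp(-(\Psi(\rho x + \eta z)-\Psi(x)))\} \ge \frac{1}{2}\exp(-\frac{1}{2}L\eta^2\,\mathrm{Tr}(\mathsf{C}))$. -/

import Mathlib

open MeasureTheory Real
open scoped ENNReal RealInnerProductSpace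

noncomputable section

abbrev Evec (d : ℕ) := EuclideanSpace ℝ (Fin d)

/-- The density of the Gaussian `𝒩(m, C)` with covariance matrix `C` at `x`. -/
def gaussDensityC {d : ℕ} (C : Matrix (Fin d) (Fin d) ℝ) (m x : Evec d) : ℝ :=
  (2 * π) ^ (-(d : ℝ) / 2) * C.det ^ (-(1 : ℝ) / 2) *
    Real.exp (-⟪x - m, Matrix.toEuclideanLin C⁻¹ (x - m)⟫ / 2)

/-- The Gaussian measure `𝒩(m, C)` on `ℝ^d`. -/
def gaussMeasC {d : ℕ} (C : Matrix (Fin d) (Fin d) ℝ) (m : Evec d) : Measure (Evec d) :=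
  volume.withDensity fun x => ENNReal.ofReal (gaussDensityC C m x)

open ProbabilityTheory

lemma map_withDensity_comp {α β : Type*} [MeasurableSpace α] [MeasurableSpace β]
    (μ : Measure α) {g : α → β} (hg : Measurable g) {f : β → ℝ≥0∞} (hf : Measurable f) :
    (μ.withDensity (f ∘ g)).map g = (μ.map g).withDensity f := by
  ext s hs
  rw [Measure.map_apply hg hs, withDensity_apply _ (hg hs), withDensity_apply _ hs,
    setLIntegral_map hs hf hg]
  rfl

lemma pi_withDensity_ofReal {ι : Type*} [Fintype ι] {α : ι → Type*} [∀ i, MeasurableSpace (α i)]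
    (μ : ∀ i, Measure (α i)) [∀ i, SigmaFinite (μ i)] {g : ∀ i, α i → ℝ}
    (hg : ∀ i, Integrable (g i) (μ i)) (hpos : ∀ i x, 0 ≤ g i x) :
    Measure.pi (fun i ↦ (μ i).withDensity fun x ↦ ENNReal.ofReal (g i x)) =
      (Measure.pi μ).withDensity fun x ↦ ENNReal.ofReal (∏ i, g i (x i)) := by
  have (i : ι) : IsFiniteMeasure ((μ i).withDensity fun x ↦ ENNReal.ofReal (g i x)) :=
    isFiniteMeasure_withDensity_ofReal (hg i).2
  refine Measure.pi_eq fun s hs ↦ ?_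
  rw [withDensity_apply _ (MeasurableSet.univ_pi hs), Measure.restrict_pi_pi,
    ← ofReal_integral_eq_lintegral_ofReal, integral_fintype_prod_eq_prod,
    ENNReal.ofReal_prod_of_nonneg fun i _ ↦ integral_nonneg (hpos i)]
  · refine Finset.prod_congr rfl fun i _ ↦ ?_
    rw [withDensity_apply _ (hs i), ofReal_integral_eq_lintegral_ofReal (hg i).integrableOn
      (.of_forall (hpos i))]
  · exact Integrable.fintype_prod_dep fun i ↦ (hg i).integrableOn
  · exact .of_forall fun x ↦ Finset.prod_nonneg fun i _ ↦ hpos i _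

lemma measurable_gaussDensityC {d : ℕ} (C : Matrix (Fin d) (Fin d) ℝ) (m : Evec d) :
    Measurable (gaussDensityC C m) := by
  have : Continuous (Matrix.toEuclideanLin C⁻¹) := LinearMap.continuous_of_finiteDimensional _
  unfold gaussDensityC
  fun_prop

lemma prod_gaussianPDFReal_eq {d : ℕ} (x : Fin d → ℝ) :
    ∏ i, gaussianPDFReal 0 1 (x i) = gaussDensityC 1 0 (WithLp.toLp 2 x) := by
  simp only [gaussianPDFReal, gaussDensityC, Finset.prod_mul_distrib, ← Real.exp_sum]
  congr 1
  · simp [Real.sqrt_eq_rpow, ← Real.rpow_neg Real.two_pi_pos.le, ← Real.rpow_natCast,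
      ← Real.rpow_mul Real.two_pi_pos.le]
    ring_nf
  · simp [EuclideanSpace.real_norm_sq_eq, Finset.sum_div, neg_div]

lemma stdGaussian_eq_gaussMeasC (d : ℕ) : stdGaussian (Evec d) = gaussMeasC 1 0 := by
  rw [← map_pi_eq_stdGaussian, gaussianReal_of_var_ne_zero 0 one_ne_zero]
  simp only [gaussianPDF_def]
  rw [pi_withDensity_ofReal _ (fun _ ↦ integrable_gaussianPDFReal 0 1)
    fun _ ↦ gaussianPDFReal_nonneg 0 1]
  simp_rw [prod_gaussianPDFReal_eq]
  have := map_withDensity_comp (volume : Measure (Fin d → ℝ))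
    (EuclideanSpace.volume_preserving_symm_measurableEquiv_toLp (Fin d)).symm.measurable
    (measurable_gaussDensityC (d := d) 1 0).ennreal_ofReal
  rw [(EuclideanSpace.volume_preserving_symm_measurableEquiv_toLp (Fin d)).symm.map_eq] at this
  exact this

open scoped MatrixOrder Matrix.Norms.L2Operator in
/-- The Gaussian measure defined by its density agrees with `multivariateGaussian`. -/
lemma multivariateGaussian_eq_gaussMeasC {d : ℕ} {C : Matrix (Fin d) (Fin d) ℝ} (hC : C.PosDef) :
    multivariateGaussian 0 C = gaussMeasC C 0 := by
  set A := CFC.sqrt C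
  have hAA : A * A = C := CFC.sqrt_mul_sqrt_self C hC.posSemidef.nonneg
  have hA0 : A.PosSemidef := Matrix.nonneg_iff_posSemidef.1 (CFC.sqrt_nonneg C)
  have hdet : A.det * A.det = C.det := by rw [← Matrix.det_mul, hAA]
  have hdetA : 0 < A.det := hA0.det_nonneg.lt_of_ne fun h ↦ hC.det_pos.ne' (by
    rw [← hdet, ← h, zero_mul])
  have hunit : IsUnit A.det := hdetA.ne'.isUnit
  have hdens (x : Evec d) : gaussDensityC 1 0 x =
      A.det * gaussDensityC C 0 (Matrix.toEuclideanLin A x) := by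
    have hrpow : C.det ^ (-(1 : ℝ) / 2) = A.det⁻¹ := by
      rw [neg_div, Real.rpow_neg hC.det_pos.le, ← Real.sqrt_eq_rpow, ← hdet,
        Real.sqrt_mul_self hdetA.le]
    have hinner : ⟪Matrix.toEuclideanLin A x,
        Matrix.toEuclideanLin C⁻¹ (Matrix.toEuclideanLin A x)⟫ = ⟪x, x⟫ := by
      have hcomp : A * (C⁻¹ * A) = 1 := by
        rw [← hAA, Matrix.mul_inv_rev, Matrix.mul_assoc, Matrix.nonsing_inv_mul A hunit,
          Matrix.mul_one, Matrix.mul_nonsing_inv A hunit]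
      rw [← LinearMap.adjoint_inner_right, ← Matrix.toEuclideanLin_conjTranspose_eq_adjoint,
        hA0.isHermitian.eq]
      simp only [Matrix.toLpLin_apply, Matrix.mulVec_mulVec, hcomp, Matrix.one_mulVec]
    simp only [gaussDensityC, sub_zero, hinner, hrpow, inv_one, Matrix.det_one, Real.one_rpow,
      Matrix.toLpLin_one, LinearMap.id_apply]
    field_simp
  have hm : Measurable (Matrix.toEuclideanLin A) :=
    (LinearMap.continuous_of_finiteDimensional _).measurable
  have hlin : LinearMap.det (Matrix.toEuclideanLin A) = A.det := by
    rw [Matrix.toEuclideanLin, Matrix.toLpLin_eq_toLin, LinearMap.det_toLin]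
  have h1 : multivariateGaussian 0 C = (gaussMeasC 1 0).map (Matrix.toEuclideanLin A) := by
    rw [multivariateGaussian, stdGaussian_eq_gaussMeasC]
    simp only [zero_add]
    rfl
  have h2 : (fun x ↦ ENNReal.ofReal (gaussDensityC 1 0 x)) =
      ENNReal.ofReal A.det • ((fun y ↦ ENNReal.ofReal (gaussDensityC C 0 y)) ∘
        Matrix.toEuclideanLin A) := by
    ext x
    simp [hdens, ENNReal.ofReal_mul hdetA.le]
  rw [h1, gaussMeasC, gaussMeasC, h2, withDensity_smul _
    ((measurable_gaussDensityC C 0).ennreal_ofReal.comp hm), Measure.map_smul,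
    map_withDensity_comp _ hm (measurable_gaussDensityC C 0).ennreal_ofReal,
    Measure.map_linearMap_addHaar_eq_smul_addHaar _ (by rw [hlin]; exact hdetA.ne'), hlin,
    withDensity_smul_measure, smul_smul, ← ENNReal.ofReal_mul hdetA.le,
    abs_of_pos (inv_pos.2 hdetA), mul_inv_cancel₀ hdetA.ne', ENNReal.ofReal_one, one_smul]

lemma integrable_norm_sq_multivariateGaussian {ι : Type*} [Fintype ι] [DecidableEq ι]
    (μ : EuclideanSpace ℝ ι) (S : Matrix ι ι ℝ) :
    Integrable (fun z ↦ ‖z‖ ^ 2) (multivariateGaussian μ S) :=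
  IsGaussian.memLp_two_id.integrable_norm_pow two_ne_zero

lemma integral_norm_sq_multivariateGaussian {ι : Type*} [Fintype ι] [DecidableEq ι]
    {S : Matrix ι ι ℝ} (hS : S.PosSemidef) :
    ∫ z, ‖z‖ ^ 2 ∂multivariateGaussian 0 S = S.trace := by
  have hmem (i : ι) : MemLp (fun z : EuclideanSpace ℝ ι ↦ z i) 2 (multivariateGaussian 0 S) :=
    (EuclideanSpace.proj (𝕜 := ℝ) i).comp_memLp' IsGaussian.memLp_two_id
  have hmean (i : ι) : ∫ z, z i ∂multivariateGaussian 0 S = 0 := by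
    have := (EuclideanSpace.proj (𝕜 := ℝ) i).integral_comp_comm
      (IsGaussian.integrable_fun_id (μ := multivariateGaussian 0 S))
    simpa using this
  simp_rw [EuclideanSpace.real_norm_sq_eq]
  rw [integral_finsetSum _ fun i _ ↦ (hmem i).integrable_sq, Matrix.trace]
  refine Finset.sum_congr rfl fun i _ ↦ ?_
  rw [Matrix.diag_apply, ← variance_eval_multivariateGaussian (μ := 0) hS i,
    variance_of_integral_eq_zero (hmem i).aemeasurable (hmean i)]

lemma isNegInvariant_gaussMeasC {d : ℕ} (C : Matrix (Fin d) (Fin d) ℝ) :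
    (gaussMeasC C 0).IsNegInvariant := by
  have heven : (fun z ↦ ENNReal.ofReal (gaussDensityC C 0 z)) =
      (fun z ↦ ENNReal.ofReal (gaussDensityC C 0 z)) ∘ Neg.neg := by
    ext z
    simp [gaussDensityC]
  refine ⟨?_⟩
  rw [Measure.neg_def]
  nth_rw 1 [gaussMeasC]
  rw [heven, map_withDensity_comp _ measurable_neg
    (measurable_gaussDensityC C 0).ennreal_ofReal, Measure.map_neg_eq_self]
  rfl

lemma min_one_mul_le {a b : ℝ} (ha : 0 ≤ a) (hb : 0 ≤ b) :
    min 1 a * min 1 b ≤ min 1 (a * b) :=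
  le_min (mul_le_one₀ (min_le_left _ _) (by positivity) (min_le_left _ _))
    (mul_le_mul (min_le_right _ _) (min_le_right _ _) (by positivity) ha)

lemma one_le_min_one_exp_add_min_one_exp_neg (t : ℝ) :
    1 ≤ min 1 (Real.exp t) + min 1 (Real.exp (-t)) := by
  rcases le_total 0 t with h | h
  · rw [min_eq_left (Real.one_le_exp h)]
    linarith [le_min zero_le_one (Real.exp_pos (-t)).le]
  · rw [min_eq_left (Real.one_le_exp (neg_nonneg.2 h))]
    linarith [le_min zero_le_one (Real.exp_pos t).le]

lemma exp_neg_integral_le {α : Type*} [MeasurableSpace α] {μ : Measure α}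
    [IsProbabilityMeasure μ] {f : α → ℝ} (hf : Integrable f μ)
    (hexp : Integrable (fun x ↦ Real.exp (-f x)) μ) :
    Real.exp (-∫ x, f x ∂μ) ≤ ∫ x, Real.exp (-f x) ∂μ := by
  rw [← integral_neg]
  exact convexOn_exp.map_integral_le Real.continuous_exp.continuousOn isClosed_univ
    (.of_forall fun _ ↦ Set.mem_univ _) hf.neg hexp

lemma sub_le_inner_add_norm_sq {E : Type*} [NormedAddCommGroup E] [InnerProductSpace ℝ E]
    [CompleteSpace E] {Ψ : E → ℝ} {L ρ η : ℝ} (hρ : ρ ∈ Set.Ioo (0 : ℝ) 1)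
    (hconv : ConvexOn ℝ Set.univ Ψ)
    (hsmooth : ∀ x h : E, Ψ (x + h) - Ψ x - ⟪gradient Ψ x, h⟫ ≤ L / 2 * ‖h‖ ^ 2)
    (hmin : ∀ x, Ψ 0 ≤ Ψ x) (x z : E) :
    Ψ (ρ • x + η • z) - Ψ x ≤
      η * ⟪gradient Ψ (ρ • x), z⟫ + L / 2 * η ^ 2 * ‖z‖ ^ 2 := by
  have h1 := hsmooth (ρ • x) (η • z)
  have h2 := hconv.2 (Set.mem_univ x) (Set.mem_univ 0) hρ.1.le (sub_nonneg.2 hρ.2.le)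
    (add_sub_cancel _ _)
  simp only [smul_zero, add_zero, smul_eq_mul] at h2
  rw [inner_smul_right, norm_smul, mul_pow, Real.norm_eq_abs, sq_abs] at h1
  nlinarith [mul_le_mul_of_nonneg_left (hmin x) (sub_nonneg.2 hρ.2.le)]

/-- Lower bound on the pCN acceptance probability for convex, `L`-smooth `Ψ`
minimized at `0`. -/
theorem stmt16 {d : ℕ} (C : Matrix (Fin d) (Fin d) ℝ) (hC : C.PosDef)
    (L ρ η : ℝ) (hL : 0 < L) (hρ : ρ ∈ Set.Ioo (0 : ℝ) 1)
    (hη : η = Real.sqrt (1 - ρ ^ 2))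
    (Ψ : Evec d → ℝ) (hΨconv : ConvexOn ℝ Set.univ Ψ) (hΨdiff : Differentiable ℝ Ψ)
    (hsmooth : ∀ x h : Evec d, Ψ (x + h) - Ψ x - ⟪gradient Ψ x, h⟫ ≤ L / 2 * ‖h‖ ^ 2)
    (hmin : ∀ x, Ψ 0 ≤ Ψ x) (x : Evec d) :
    (1 / 2) * Real.exp (-(1 / 2) * L * η ^ 2 * C.trace) ≤
      ∫ z, min 1 (Real.exp (-(Ψ (ρ • x + η • z) - Ψ x))) ∂gaussMeasC C 0 := by
  have hμ := multivariateGaussian_eq_gaussMeasC hC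
  have : IsProbabilityMeasure (gaussMeasC C 0) := hμ ▸ inferInstance
  have := isNegInvariant_gaussMeasC C
  set q : Evec d → ℝ := fun z ↦ L / 2 * η ^ 2 * ‖z‖ ^ 2 with hq
  set g : Evec d → ℝ := fun z ↦ η * ⟪gradient Ψ (ρ • x), z⟫ with hg
  set f : Evec d → ℝ := fun z ↦ min 1 (Real.exp (-(Ψ (ρ • x + η • z) - Ψ x)))
  have hcont : Continuous Ψ := hΨdiff.continuous
  have hq0 (z : Evec d) : 0 ≤ q z := by positivity
  have hqint : Integrable q (gaussMeasC C 0) :=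
    (hμ ▸ integrable_norm_sq_multivariateGaussian 0 C).const_mul _
  have hqmean : ∫ z, q z ∂gaussMeasC C 0 = L / 2 * η ^ 2 * C.trace := by
    rw [hq, integral_const_mul, ← hμ, integral_norm_sq_multivariateGaussian hC.posSemidef]
  have hqexp : Integrable (fun z ↦ Real.exp (-q z)) (gaussMeasC C 0) :=
    .of_bound (by fun_prop) 1 (.of_forall fun z ↦ by simpa using hq0 z)
  have hfint : Integrable f (gaussMeasC C 0) :=
    .of_bound (by fun_prop) 1 (.of_forall fun z ↦ by
      rw [Real.norm_of_nonneg (by positivity)]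
      exact min_le_left _ _)
  have hlow (z : Evec d) : min 1 (Real.exp (-g z)) * Real.exp (-q z) ≤ f z := calc
    _ = min 1 (Real.exp (-g z)) * min 1 (Real.exp (-q z)) := by
      rw [min_eq_right (Real.exp_le_one_iff.2 (neg_nonpos.2 (hq0 z)))]
    _ ≤ min 1 (Real.exp (-g z) * Real.exp (-q z)) :=
      min_one_mul_le (Real.exp_pos _).le (Real.exp_pos _).le
    _ ≤ f z := by
      refine min_le_min_left 1 ?_
      rw [← Real.exp_add]
      refine Real.exp_le_exp.2 ?_
      have hbound : _ ≤ g z + q z := sub_le_inner_add_norm_sq hρ hΨconv hsmooth hmin x z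
      linarith
  have hsum (z : Evec d) : Real.exp (-q z) ≤ f z + f (-z) := by
    have h1 := hlow z
    have h2 := hlow (-z)
    have hgneg : g (-z) = -g z := by simp [hg]
    have hqneg : q (-z) = q z := by simp [hq]
    rw [hgneg, hqneg] at h2
    have h3 := one_le_min_one_exp_add_min_one_exp_neg (-g z)
    nlinarith [mul_le_mul_of_nonneg_right h3 (Real.exp_pos (-q z)).le]
  have hkey : ∫ z, Real.exp (-q z) ∂gaussMeasC C 0 ≤ 2 * ∫ z, f z ∂gaussMeasC C 0 := calc
    _ ≤ ∫ z, f z + f (-z) ∂gaussMeasC C 0 := integral_mono hqexp (hfint.add hfint.comp_neg) hsum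
    _ = _ := by rw [integral_add hfint hfint.comp_neg, integral_neg_eq_self, two_mul]
  have hjensen := exp_neg_integral_le hqint hqexp
  rw [hqmean] at hjensen
  rw [show -(1 / 2) * L * η ^ 2 * C.trace = -(L / 2 * η ^ 2 * C.trace) by ring]
  linarith
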